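/- Let T be a 2-tree on [n−1]. Then for every edge e of T with e ≠ {1,2}, one has a_e + 1 = Σ_{f ∈ dec(e)} 2·(2 − v_T(f)). -/

import Mathlib

namespace MinKin

noncomputable section

attribute [local instance] Classical.propDecidable

open scoped BigOperators

/-- First row of the 2×n matrix X, at column `j` (1-based). -/
def colA (n j : ℕ) : ℂ := if j = n then 0 else 1

/-- Second row of X at column `j` (1-based): `(0,1,x_1,…,x_{n-3},1)`. -/
def colB (n : ℕ) (x : Fin (n - 3) → ℂ) (j : ℕ) : ℂ :=
  if j = 1 then 0
  else if j = 2 then 1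
  else if j = n then 1
  else if h : j - 3 < n - 3 then x ⟨j - 3, h⟩ else 0

/-- The Plücker coordinate `p_{ij}(x)`, the 2×2 minor of X on columns i and j. -/
def pc (n : ℕ) (x : Fin (n - 3) → ℂ) (i j : ℕ) : ℂ :=
  colA n i * colB n x j - colA n j * colB n x i

/-- The partial derivative `∂p_{ij}/∂x_m` (with `m : Fin (n-3)` zero-based, so that
the variable `x m` appears in column `(m:ℕ)+3` of X). -/
def dpc (n : ℕ) (i j : ℕ) (m : Fin (n - 3)) : ℂ :=
  colA n i * (if j = (m : ℕ) + 3 then (1 : ℂ) else 0)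
    - colA n j * (if i = (m : ℕ) + 3 then (1 : ℂ) else 0)

/-- The index set `S = {(i,j) : 1 ≤ i < j ≤ n-1, (i,j) ≠ (1,2)}`. -/
def Sfin (n : ℕ) : Finset (ℕ × ℕ) :=
  ((Finset.Icc 1 (n - 1)) ×ˢ (Finset.Icc 1 (n - 1))).filter
    (fun e => e.1 < e.2 ∧ e ≠ (1, 2))

/-- The domain `U = {x : p_{ij}(x) ≠ 0 for all (i,j) ∈ S}`. -/
def Udom (n : ℕ) : Set (Fin (n - 3) → ℂ) :=
  {x | ∀ e ∈ Sfin n, pc n x e.1 e.2 ≠ 0}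

/-- `x` is a critical point of `L_{T₀} = Σ_{e ∈ T₀} s_e · log p_e`. -/
def IsCrit (n : ℕ) (T₀ : Finset (ℕ × ℕ)) (s : ℕ × ℕ → ℂ) (x : Fin (n - 3) → ℂ) : Prop :=
  ∀ m : Fin (n - 3), ∑ e ∈ T₀, s e * dpc n e.1 e.2 m / pc n x e.1 e.2 = 0

/-- Edge sets built inductively from the parent choices `par`. -/
def edgesUpTo (par : ℕ → ℕ × ℕ) : ℕ → Finset (ℕ × ℕ)
  | 0 => {(1, 2)}
  | k + 1 =>
      if k + 1 < 3 then {(1, 2)}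
      else edgesUpTo par k ∪ {((par (k + 1)).1, k + 1), ((par (k + 1)).2, k + 1)}

/-- A 2-tree on `[n-1]`: for each `k = 3,…,n-1` an already-present edge
`par k = (i_k, j_k)` with `i_k < j_k ≤ k-1` is chosen, and the edges
`(i_k, k)` and `(j_k, k)` are added. -/
structure TwoTree (n : ℕ) : Type where
  par : ℕ → ℕ × ℕ
  lt : ∀ k, 3 ≤ k → k ≤ n - 1 → (par k).1 < (par k).2 ∧ (par k).2 < k
  mem : ∀ k, 3 ≤ k → k ≤ n - 1 → par k ∈ edgesUpTo par (k - 1)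

/-- The edge set of a 2-tree. -/
def TwoTree.edges {n : ℕ} (T : TwoTree n) : Finset (ℕ × ℕ) := edgesUpTo T.par (n - 1)

/-- A finite edge set is a 2-tree on `[n-1]`. -/
def IsTwoTree (n : ℕ) (E : Finset (ℕ × ℕ)) : Prop := ∃ T : TwoTree n, T.edges = E

/-- `c` is a child of `e` in the 2-tree `T`. -/
def Child (n : ℕ) (T : TwoTree n) (e c : ℕ × ℕ) : Prop :=
  ∃ k, 3 ≤ k ∧ k ≤ n - 1 ∧ T.par k = e ∧ (c = (e.1, k) ∨ c = (e.2, k))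

/-- The set `dec(e)` of descendants of the edge `e` (including `e` itself). -/
def dec (n : ℕ) (T : TwoTree n) (e : ℕ × ℕ) : Finset (ℕ × ℕ) :=
  T.edges.filter (fun f => Relation.ReflTransGen (Child n T) e f)

/-- The bracket `[s_e] = Σ_{f ∈ dec(e)} s_f`. -/
def brk (n : ℕ) (T : TwoTree n) (s : ℕ × ℕ → ℂ) (e : ℕ × ℕ) : ℂ :=
  ∑ f ∈ dec n T e, s f

/-- The Mandelstam invariants `s` are generic for `T`. -/
def Generic (n : ℕ) (T : TwoTree n) (s : ℕ × ℕ → ℂ) : Prop :=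
  ∀ k, 3 ≤ k → k ≤ n - 1 →
    brk n T s ((T.par k).1, k) ≠ 0 ∧ brk n T s ((T.par k).2, k) ≠ 0 ∧
      brk n T s ((T.par k).1, k) + brk n T s ((T.par k).2, k) ≠ 0

/-- `a_e = |dec(e)|`. -/
def aA (n : ℕ) (T : TwoTree n) (e : ℕ × ℕ) : ℕ := (dec n T e).card

/-- `v_T(e)`: the number of triangles of `T` containing the edge `e`. -/
def vT (n : ℕ) (T : TwoTree n) (e : ℕ × ℕ) : ℕ :=
  ((Finset.Icc 3 (n - 1)).filter
    (fun k => e = T.par k ∨ e = ((T.par k).1, k) ∨ e = ((T.par k).2, k))).card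

/-- The Horn product `P_e(s)`: over all ancestral triangles `{i,j,k}` of `e`, the
factor `[s_c]/([s_{(i,k)}]+[s_{(j,k)}])` where `c` is the child containing `e`
among its descendants. -/
def hornP (n : ℕ) (T : TwoTree n) (s : ℕ × ℕ → ℂ) (e : ℕ × ℕ) : ℂ :=
  ∏ k ∈ Finset.Icc 3 (n - 1),
    (if e ∈ dec n T ((T.par k).1, k) then
        brk n T s ((T.par k).1, k)
          / (brk n T s ((T.par k).1, k) + brk n T s ((T.par k).2, k))
      else if e ∈ dec n T ((T.par k).2, k) then
        brk n T s ((T.par k).2, k)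
          / (brk n T s ((T.par k).1, k) + brk n T s ((T.par k).2, k))
      else 1)

/-- Auxiliary recursion for the signs `ε_e`. -/
def epsAux (par : ℕ → ℕ × ℕ) : ℕ → ℕ × ℕ → ℂ
  | 0, _ => 1
  | k + 1, e =>
      if e = (1, 2) then 1
      else if e = ((par (k + 1)).1, k + 1) then epsAux par k (par (k + 1))
      else if e = ((par (k + 1)).2, k + 1) then -(epsAux par k (par (k + 1)))
      else epsAux par k e

/-- The sign `ε_e ∈ {1,-1}`: `ε_{(1,2)} = 1`, `ε_{(i,k)} = ε_{(i,j)}`,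
`ε_{(j,k)} = -ε_{(i,j)}` for each triangle `{i,j,k}`. -/
def eps (n : ℕ) (T : TwoTree n) (e : ℕ × ℕ) : ℂ := epsAux T.par (n - 1) e

/-- The negated Hessian matrix `𝓗(x) = -Hess(L_{T₀})(x)`. -/
def negHess (n : ℕ) (T₀ : Finset (ℕ × ℕ)) (s : ℕ × ℕ → ℂ) (x : Fin (n - 3) → ℂ) :
    Matrix (Fin (n - 3)) (Fin (n - 3)) ℂ :=
  Matrix.of fun (l m : Fin (n - 3)) =>
    ∑ e ∈ T₀, s e * dpc n e.1 e.2 l * dpc n e.1 e.2 m / pc n x e.1 e.2 ^ 2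

/-- The on-shell diagram of `T`: the triangles of `T` together with `(1,2,n)`. -/
def triples (n : ℕ) (T : TwoTree n) : Finset (ℕ × ℕ × ℕ) :=
  insert (1, 2, n) ((Finset.Icc 3 (n - 1)).image fun k => ((T.par k).1, (T.par k).2, k))

/-- The edge `e` is contained in the triple `t`. -/
def inTriple (e : ℕ × ℕ) (t : ℕ × ℕ × ℕ) : Prop :=
  e = (t.1, t.2.1) ∨ e = (t.1, t.2.2) ∨ e = (t.2.1, t.2.2)

/-- `ṽ(e)`: the number of triples of the on-shell diagram containing `e`. -/
def vTil (n : ℕ) (T : TwoTree n) (e : ℕ × ℕ) : ℕ :=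
  ((triples n T).filter (inTriple e)).card

/-- The edges contained in at least one triple of the on-shell diagram. -/
def diagEdges (n : ℕ) (T : TwoTree n) : Finset (ℕ × ℕ) :=
  (triples n T).biUnion fun t => {(t.1, t.2.1), (t.1, t.2.2), (t.2.1, t.2.2)}

/-- The CHY integrand `I_T(x) = Π_e p_e(x)^{ṽ(e)-2}`. -/
def integrand (n : ℕ) (T : TwoTree n) (x : Fin (n - 3) → ℂ) : ℂ :=
  ∏ e ∈ diagEdges n T, pc n x e.1 e.2 ^ ((vTil n T e : ℤ) - 2)

/-- The Horn matrix `H_T`: rows come in consecutive triples indexed by the triangles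
(in order k = 3,…,n-1), columns indexed by the non-initial edges of `T`
(in order (i_3,3),(j_3,3),(i_4,4),(j_4,4),…). -/
def HornMat (n : ℕ) (T : TwoTree n) : Matrix (Fin (3 * n - 9)) (Fin (2 * n - 6)) ℤ :=
  Matrix.of fun (ρ : Fin (3 * n - 9)) (c : Fin (2 * n - 6)) =>
    let k := (ρ : ℕ) / 3 + 3
    let c1 : ℕ × ℕ := ((T.par k).1, k)
    let c2 : ℕ × ℕ := ((T.par k).2, k)
    let kc := (c : ℕ) / 2 + 3
    let e : ℕ × ℕ := if (c : ℕ) % 2 = 0 then ((T.par kc).1, kc) else ((T.par kc).2, kc)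
    if (ρ : ℕ) % 3 = 0 then (if e ∈ dec n T c1 then 1 else 0)
    else if (ρ : ℕ) % 3 = 1 then (if e ∈ dec n T c2 then 1 else 0)
    else (if e ∈ dec n T c1 ∨ e ∈ dec n T c2 then -1 else 0)

/-- The matrix `A` whose r-th row has 1 in columns 3r-2, 3r-1, 3r (1-based). -/
def Amat (n : ℕ) : Matrix (Fin (n - 3)) (Fin (3 * n - 9)) ℤ :=
  Matrix.of fun (r : Fin (n - 3)) (c : Fin (3 * n - 9)) =>
    if (c : ℕ) / 3 = (r : ℕ) then 1 else 0

/-- Polynomial version of the first row of X. -/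
def colAP (n : ℕ) (j : ℕ) : MvPolynomial (Fin (n - 3)) ℂ := if j = n then 0 else 1

/-- Polynomial version of the second row of X. -/
def colBP (n : ℕ) (j : ℕ) : MvPolynomial (Fin (n - 3)) ℂ :=
  if j = 1 then 0
  else if j = 2 then 1
  else if j = n then 1
  else if h : j - 3 < n - 3 then MvPolynomial.X ⟨j - 3, h⟩ else 0

/-- The Plücker coordinate `p_{ij}` as a polynomial in `ℂ[x_1,…,x_{n-3}]`. -/
def pcP (n : ℕ) (i j : ℕ) : MvPolynomial (Fin (n - 3)) ℂ :=
  colAP n i * colBP n j - colAP n j * colBP n i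

/-- The r-th triple (0-based row index) of the on-shell diagram of `T`. -/
def tripleOf (n : ℕ) (T : TwoTree n) (r : ℕ) : ℕ × ℕ × ℕ :=
  if r + 3 ≤ n - 1 then ((T.par (r + 3)).1, (T.par (r + 3)).2, r + 3) else (1, 2, n)

/-- The matrix `M_T` over `ℂ[x_1,…,x_{n-3}]`, whose row indexed by a triple
`{i,j,k}` (i<j<k) is `p_{jk}·e_i - p_{ik}·e_j + p_{ij}·e_k`. -/
def Mmat (n : ℕ) (T : TwoTree n) :
    Matrix (Fin (n - 2)) (Fin n) (MvPolynomial (Fin (n - 3)) ℂ) :=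
  Matrix.of fun (r : Fin (n - 2)) (c : Fin n) =>
    if (c : ℕ) + 1 = (tripleOf n T r).1 then
      pcP n (tripleOf n T r).2.1 (tripleOf n T r).2.2
    else if (c : ℕ) + 1 = (tripleOf n T r).2.1 then
      -pcP n (tripleOf n T r).1 (tripleOf n T r).2.2
    else if (c : ℕ) + 1 = (tripleOf n T r).2.2 then
      pcP n (tripleOf n T r).1 (tripleOf n T r).2.1
    else 0

/-- The matrix `M_T` evaluated at a point `x ∈ ℂ^{n-3}`. -/
def MmatC (n : ℕ) (T : TwoTree n) (x : Fin (n - 3) → ℂ) : Matrix (Fin (n - 2)) (Fin n) ℂ :=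
  Matrix.of fun (r : Fin (n - 2)) (c : Fin n) =>
    if (c : ℕ) + 1 = (tripleOf n T r).1 then
      pc n x (tripleOf n T r).2.1 (tripleOf n T r).2.2
    else if (c : ℕ) + 1 = (tripleOf n T r).2.1 then
      -pc n x (tripleOf n T r).1 (tripleOf n T r).2.2
    else if (c : ℕ) + 1 = (tripleOf n T r).2.2 then
      pc n x (tripleOf n T r).1 (tripleOf n T r).2.1
    else 0

/-- The 2×n matrix X evaluated at `x`. -/
def Xmat (n : ℕ) (x : Fin (n - 3) → ℂ) : Matrix (Fin 2) (Fin n) ℂ :=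
  Matrix.of fun (r : Fin 2) (c : Fin n) =>
    if r = 0 then colA n ((c : ℕ) + 1) else colB n x ((c : ℕ) + 1)

/-- The monotone embedding `Fin (n-2) → Fin n` skipping the (0-based) positions
`a < b`. -/
def delCols (n a b : ℕ) (d : Fin (n - 2)) : Fin n :=
  ⟨if (d : ℕ) < a then (d : ℕ) else if (d : ℕ) + 1 < b then (d : ℕ) + 1 else (d : ℕ) + 2, by
    have := d.isLt; split_ifs <;> omega⟩

/-- The maximal minor of `M_T` obtained by deleting columns `i < j` (1-based). -/
def maxMinor (n : ℕ) (T : TwoTree n) (i j : ℕ) : MvPolynomial (Fin (n - 3)) ℂ :=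
  Matrix.det (Matrix.of fun (r d : Fin (n - 2)) => Mmat n T r (delCols n (i - 1) (j - 1) d))

/-- `Δ_T = Π_e p_e^{ṽ(e)-1}`. -/
def DeltaT (n : ℕ) (T : TwoTree n) : MvPolynomial (Fin (n - 3)) ℂ :=
  ∏ e ∈ diagEdges n T, pcP n e.1 e.2 ^ (vTil n T e - 1)

/-- `T₀` has, for generic coefficients, exactly one critical point in `U`. -/
def UniqueCritGeneric (n : ℕ) (T₀ : Finset (ℕ × ℕ)) : Prop :=
  ∃ g : MvPolynomial {e : ℕ × ℕ // e ∈ T₀} ℂ, g ≠ 0 ∧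
    ∀ s : ℕ × ℕ → ℂ, MvPolynomial.eval (fun v => s v.1) g ≠ 0 →
      ∃! x : Fin (n - 3) → ℂ, x ∈ Udom n ∧ IsCrit n T₀ s x

/-- `T₀ ⊆ S` exhibits minimal kinematics. -/
def ExhibitsMinKin (n : ℕ) (T₀ : Finset (ℕ × ℕ)) : Prop :=
  T₀ ⊆ Sfin n ∧ UniqueCritGeneric n T₀ ∧
    ∀ T₁ : Finset (ℕ × ℕ), T₁ ⊆ Sfin n → T₀ ⊆ T₁ → UniqueCritGeneric n T₁ → T₁ = T₀
theorem mem_edgesUpTo (par : ℕ → ℕ × ℕ) (m : ℕ) (f : ℕ × ℕ) :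
    f ∈ edgesUpTo par m ↔
      f = (1, 2) ∨ ∃ k, 3 ≤ k ∧ k ≤ m ∧ (f = ((par k).1, k) ∨ f = ((par k).2, k)) := by
  induction m with
  | zero =>
    simp only [edgesUpTo, Finset.mem_singleton]
    exact ⟨Or.inl, fun h => h.resolve_right fun ⟨k, h₁, h₂, _⟩ => by omega⟩
  | succ m ih =>
    rw [edgesUpTo]
    split_ifs with hm
    · simp only [Finset.mem_singleton]
      exact ⟨Or.inl, fun h => h.resolve_right fun ⟨k, h₁, h₂, _⟩ => by omega⟩
    · simp only [Finset.mem_union, ih, Finset.mem_insert, Finset.mem_singleton]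
      constructor
      · rintro ((h | ⟨k, h₁, h₂, h⟩) | h)
        · exact Or.inl h
        · exact Or.inr ⟨k, h₁, by omega, h⟩
        · exact Or.inr ⟨m + 1, by omega, le_rfl, h⟩
      · rintro (h | ⟨k, h₁, h₂, h⟩)
        · exact Or.inl (Or.inl h)
        · obtain rfl | hk := eq_or_ne k (m + 1)
          · exact Or.inr h
          · exact Or.inl (Or.inr ⟨k, h₁, by omega, h⟩)

theorem TwoTree.par_mem_edges {n : ℕ} (T : TwoTree n) {k : ℕ} (h₁ : 3 ≤ k) (h₂ : k ≤ n - 1) :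
    T.par k ∈ T.edges := by
  refine (mem_edgesUpTo _ _ _).2 (((mem_edgesUpTo _ _ _).1 (T.mem k h₁ h₂)).imp_right ?_)
  rintro ⟨l, h₃, h₄, h⟩
  exact ⟨l, h₃, by omega, h⟩

theorem Child.snd_lt {n : ℕ} {T : TwoTree n} {e c : ℕ × ℕ} (h : Child n T e c) : e.2 < c.2 := by
  obtain ⟨k, h₁, h₂, rfl, rfl | rfl⟩ := h <;> exact (T.lt k h₁ h₂).2

theorem Child.mem_edges {n : ℕ} {T : TwoTree n} {e c : ℕ × ℕ} (h : Child n T e c) :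
    c ∈ T.edges := by
  obtain ⟨k, h₁, h₂, rfl, h⟩ := h
  exact (mem_edgesUpTo _ _ _).2 (Or.inr ⟨k, h₁, h₂, h⟩)

theorem snd_le_of_mem_dec {n : ℕ} {T : TwoTree n} {e f : ℕ × ℕ} (h : f ∈ dec n T e) :
    e.2 ≤ f.2 := by
  have hr := (Finset.mem_filter.1 h).2
  induction hr with
  | refl => exact le_rfl
  | tail hab hbc ih =>
    have := hbc.snd_lt
    obtain ⟨k, h₁, h₂, rfl, -⟩ := hbc
    exact (ih (Finset.mem_filter.2 ⟨T.par_mem_edges h₁ h₂, hab⟩)).trans this.le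

/-- The apexes of the triangles of `T` whose parent edge is a descendant of `e`. -/
def apexes (n : ℕ) (T : TwoTree n) (e : ℕ × ℕ) : Finset ℕ :=
  (Finset.Icc 3 (n - 1)).filter fun k => T.par k ∈ dec n T e

theorem dec_eq_insert {n : ℕ} {T : TwoTree n} {e : ℕ × ℕ} (he : e ∈ T.edges) :
    dec n T e = insert e
      ((apexes n T e).biUnion fun k => {((T.par k).1, k), ((T.par k).2, k)}) := by
  ext f
  simp only [apexes, Finset.mem_insert, Finset.mem_biUnion, Finset.mem_filter, Finset.mem_Icc,
    Finset.mem_singleton]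
  constructor
  · intro hf
    obtain ⟨hfE, hr⟩ := Finset.mem_filter.1 hf
    rcases Relation.ReflTransGen.cases_tail hr with h | ⟨c, hc, k, h₁, h₂, rfl, h⟩
    · exact Or.inl h
    · exact Or.inr ⟨k, ⟨⟨h₁, h₂⟩, Finset.mem_filter.2 ⟨T.par_mem_edges h₁ h₂, hc⟩⟩, h⟩
  · rintro (rfl | ⟨k, ⟨⟨h₁, h₂⟩, hk⟩, h⟩)
    · exact Finset.mem_filter.2 ⟨he, .refl⟩
    · have hc : Child n T (T.par k) f := ⟨k, h₁, h₂, rfl, h⟩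
      exact Finset.mem_filter.2 ⟨hc.mem_edges, (Finset.mem_filter.1 hk).2.tail hc⟩

theorem aA_eq {n : ℕ} {T : TwoTree n} {e : ℕ × ℕ} (he : e ∈ T.edges) :
    aA n T e = 2 * (apexes n T e).card + 1 := by
  rw [aA, dec_eq_insert he, Finset.card_insert_of_notMem, Finset.card_biUnion]
  · rw [Finset.sum_const_nat (m := 2), mul_comm]
    intro k hk
    simp only [apexes, Finset.mem_filter, Finset.mem_Icc] at hk
    refine Finset.card_pair fun h => ?_
    exact (T.lt k hk.1.1 hk.1.2).1.ne (congrArg Prod.fst h)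
  · intro k _ l _ hkl
    rw [Function.onFun, Finset.disjoint_left]
    simp only [Finset.mem_insert, Finset.mem_singleton]
    rintro f (rfl | rfl) (h | h) <;> exact hkl (congrArg Prod.snd h)
  · simp only [apexes, Finset.mem_biUnion, Finset.mem_filter, Finset.mem_Icc,
      Finset.mem_insert, Finset.mem_singleton]
    rintro ⟨k, ⟨⟨h₁, h₂⟩, hk⟩, h⟩
    have hlt := (T.lt k h₁ h₂).2
    have hle := snd_le_of_mem_dec hk
    have : e.2 = k := by rcases h with h | h <;> rw [h]
    omega

theorem vT_eq {n : ℕ} {T : TwoTree n} {f : ℕ × ℕ} (hf : f ∈ T.edges) (hf' : f ≠ (1, 2)) :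
    vT n T f = ((Finset.Icc 3 (n - 1)).filter fun k => T.par k = f).card + 1 := by
  obtain ⟨k, h₁, h₂, h⟩ := ((mem_edgesUpTo _ _ _).1 hf).resolve_left hf'
  have hk : f.2 = k := by rcases h with h | h <;> rw [h]
  have hlt := (T.lt k h₁ h₂).2
  rw [vT, ← Finset.card_insert_of_notMem (a := k)]
  · congr 1
    ext l
    simp only [Finset.mem_filter, Finset.mem_Icc, Finset.mem_insert]
    constructor
    · rintro ⟨hl, rfl | hl' | hl'⟩
      · exact Or.inr ⟨hl, rfl⟩
      · exact Or.inl (by rw [← hk, hl'])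
      · exact Or.inl (by rw [← hk, hl'])
    · rintro (rfl | ⟨hl, rfl⟩)
      · exact ⟨⟨h₁, h₂⟩, Or.inr h⟩
      · exact ⟨hl, Or.inl rfl⟩
  · rw [Finset.mem_filter]
    rintro ⟨-, rfl⟩
    omega

theorem sum_vT_dec {n : ℕ} {T : TwoTree n} {e : ℕ × ℕ} (he : e ∈ T.edges) (he' : e ≠ (1, 2)) :
    ∑ f ∈ dec n T e, vT n T f = (apexes n T e).card + aA n T e := by
  have he₂ : 3 ≤ e.2 := by
    obtain ⟨k, h₁, h₂, h⟩ := ((mem_edgesUpTo _ _ _).1 he).resolve_left he'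
    rcases h with h | h <;> rw [h] <;> exact h₁
  have hv : ∀ f ∈ dec n T e,
      vT n T f = ((apexes n T e).filter fun k => T.par k = f).card + 1 := by
    intro f hf
    have hle := snd_le_of_mem_dec hf
    rw [vT_eq (Finset.mem_filter.1 hf).1 (by rintro rfl; simp at hle; omega), apexes,
      Finset.filter_filter]
    congr 2
    refine Finset.filter_congr fun k _ => ⟨?_, And.right⟩
    rintro rfl
    exact ⟨hf, rfl⟩
  rw [Finset.sum_congr rfl hv, Finset.sum_add_distrib, ← Finset.card_eq_sum_card_fiberwise]
  · simp [aA]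
  · exact fun k hk => (Finset.mem_filter.1 hk).2

/-- the key combinatorial identity
a_e + 1 = Σ_{f ∈ dec(e)} 2(2 - v_T(f)) for every edge e ≠ (1,2) of T. -/
theorem key_combinatorial_identity (n : ℕ) (hn : 4 ≤ n) (T : TwoTree n) :
    ∀ e ∈ T.edges, e ≠ (1, 2) →
      (aA n T e : ℤ) + 1 = ∑ f ∈ dec n T e, 2 * (2 - (vT n T f : ℤ)) := by
  intro e he he'
  have ha := aA_eq he
  have hv := sum_vT_dec he he'
  have hs : ∑ f ∈ dec n T e, 2 * (2 - (vT n T f : ℤ)) =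
      4 * (aA n T e : ℤ) - 2 * ((∑ f ∈ dec n T e, vT n T f : ℕ) : ℤ) := by
    rw [← Finset.mul_sum, Finset.sum_sub_distrib, Finset.sum_const, aA]
    push_cast
    ring
  rw [hs, hv]
  push_cast
  omega

end
end MinKin
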